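/- Let m, d ≥ 1 and let f : ℝ^m → ℝ^d be smooth in a neighborhood of 0 with f(0) = 0 and Df(0) = 0. For u near 0 let G(u) be the m×m matrix with entries G_{ij}(u) = δ_{ij} + ⟨∂_i f(u), ∂_j f(u)⟩ and let (g^{ij}(u)) = G(u)^{−1}. Define the mean curvature vector H(u) ∈ ℝ^m × ℝ^d by its components: H^σ(u) = −Σ_{i,j,p} g^{ij}(u) g^{σp}(u) ⟨∂_p f(u), ∂_i∂_j f(u)⟩ for 1 ≤ σ ≤ m, and H^{m+τ}(u) = Σ_{i,j} g^{ij}(u) ∂_i∂_j f^τ(u) − Σ_{i,j,k,p} g^{ij}(u) g^{kp}(u) ⟨∂_p f(u), ∂_i∂_j f(u)⟩ ∂_k f^τ(u) for 1 ≤ τ ≤ d (all indices i,j,k,p ranging over 1,…,m; f^τ the components of f). Then, writing f_{ij} = ∂_i∂_j f(0), f_{ijk} = ∂_i∂_j∂_k f(0), f_{iiℓℓ} = ∂_i²∂_ℓ² f(0), the Euclidean Laplacian of ‖H‖² at 0 satisfies Σ_{ℓ} ∂_ℓ²(‖H‖²)(0) = −2 Σ_{i,j,k,ℓ} ⟨f_{ii},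 f_{kℓ}⟩⟨f_{jj}, f_{kℓ}⟩ − 4 Σ_{i,j,k,ℓ} ⟨f_{iℓ}, f_{jℓ}⟩⟨f_{ij}, f_{kk}⟩ + 2 Σ_{i,j,k} ⟨f_{iik}, f_{jjk}⟩ + 2 Σ_{i,k,ℓ} ⟨f_{kk}, f_{iiℓℓ}⟩, all indices summed over 1, …, m. -/

import Mathlib

/-- The partial derivative `∂_i g(u)` of a function `g : ℝ^m → ℝ`. -/
noncomputable def pd {m : ℕ} (i : Fin m) (g : (Fin m → ℝ) → ℝ) (u : Fin m → ℝ) : ℝ :=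
  fderiv ℝ g u (Pi.single i 1)

open Filter Topology

def HasJet {m : ℕ} (l : Fin m) (g : (Fin m → ℝ) → ℝ) (a b c : ℝ) : Prop :=
  ContDiffAt ℝ (⊤ : ℕ∞) g 0 ∧ g 0 = a ∧ pd l g 0 = b ∧ pd l (fun u => pd l g u) 0 = c

lemma smooth_ev {m : ℕ} {g : (Fin m → ℝ) → ℝ} {x : Fin m → ℝ}
    (hg : ContDiffAt ℝ (⊤ : ℕ∞) g x) :
    ∀ᶠ u in 𝓝 x, DifferentiableAt ℝ g u := by
  have h1 : ContDiffAt ℝ ((1 : ℕ) : WithTop ℕ∞) g x := hg.of_le (by exact_mod_cast le_top)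
  filter_upwards [h1.eventually (by simp)] with u hu
  exact hu.differentiableAt (by simp)

lemma smooth_pd {m : ℕ} {g : (Fin m → ℝ) → ℝ} {x : Fin m → ℝ} (l : Fin m)
    (hg : ContDiffAt ℝ (⊤ : ℕ∞) g x) : ContDiffAt ℝ (⊤ : ℕ∞) (fun u => pd l g u) x := by
  unfold pd
  exact (hg.fderiv_right (m := (⊤ : ℕ∞)) (by simp)).clm_apply contDiffAt_const

lemma smooth_diff {m : ℕ} {g : (Fin m → ℝ) → ℝ} {x : Fin m → ℝ}
    (hg : ContDiffAt ℝ (⊤ : ℕ∞) g x) : DifferentiableAt ℝ g x :=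
  hg.differentiableAt (by simp)

lemma pd_congr {m : ℕ} {g h : (Fin m → ℝ) → ℝ} {x : Fin m → ℝ} (l : Fin m)
    (e : g =ᶠ[𝓝 x] h) : pd l g x = pd l h x := by
  unfold pd; rw [e.fderiv_eq]

lemma pd_congr_ev {m : ℕ} {g h : (Fin m → ℝ) → ℝ} {x : Fin m → ℝ} (l : Fin m)
    (e : g =ᶠ[𝓝 x] h) : (fun u => pd l g u) =ᶠ[𝓝 x] (fun u => pd l h u) := by
  filter_upwards [e.eventuallyEq_nhds] with u hu using pd_congr l hu

lemma pd_add {m : ℕ} {g h : (Fin m → ℝ) → ℝ} {x : Fin m → ℝ} (l : Fin m)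
    (hg : DifferentiableAt ℝ g x) (hh : DifferentiableAt ℝ h x) :
    pd l (fun u => g u + h u) x = pd l g x + pd l h x := by
  unfold pd; rw [fderiv_fun_add hg hh]; simp

lemma pd_mul {m : ℕ} {g h : (Fin m → ℝ) → ℝ} {x : Fin m → ℝ} (l : Fin m)
    (hg : DifferentiableAt ℝ g x) (hh : DifferentiableAt ℝ h x) :
    pd l (fun u => g u * h u) x = g x * pd l h x + h x * pd l g x := by
  unfold pd; rw [fderiv_fun_mul hg hh]; simp

lemma pd_const {m : ℕ} (l : Fin m) (k : ℝ) (x : Fin m → ℝ) :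
    pd l (fun _ => k) x = 0 := by
  unfold pd; simp

lemma pd_comm {m : ℕ} {g : (Fin m → ℝ) → ℝ} {x : Fin m → ℝ} (i j : Fin m)
    (hg : ContDiffAt ℝ (⊤ : ℕ∞) g x) :
    pd i (fun u => pd j g u) x = pd j (fun u => pd i g u) x := by
  have hs : IsSymmSndFDerivAt ℝ g x := hg.isSymmSndFDerivAt (by simp only [minSmoothness_of_isRCLikeNormedField]; exact WithTop.coe_le_coe.mpr le_top)
  have hd : DifferentiableAt ℝ (fderiv ℝ g) x :=
    (hg.fderiv_right (m := (⊤ : ℕ∞)) (by simp)).differentiableAt (by simp)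
  have key : ∀ a b : Fin m, pd a (fun u => pd b g u) x
      = fderiv ℝ (fderiv ℝ g) x (Pi.single a 1) (Pi.single b 1) := by
    intro a b
    unfold pd
    rw [fderiv_clm_apply hd (differentiableAt_const _)]
    simp
  rw [key, key]
  exact hs _ _

section

variable {m : ℕ} {l : Fin m}

lemma HasJet.congr {g h : (Fin m → ℝ) → ℝ} {a b c : ℝ} (hg : HasJet l g a b c)
    (e : h =ᶠ[𝓝 0] g) : HasJet l h a b c := by
  obtain ⟨h1, h2, h3, h4⟩ := hg
  exact ⟨h1.congr_of_eventuallyEq e, by rw [e.eq_of_nhds, h2], by rw [pd_congr l e, h3],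
    by rw [pd_congr l (pd_congr_ev l e), h4]⟩

lemma HasJet.eq {g : (Fin m → ℝ) → ℝ} {a b c a' b' c' : ℝ} (hg : HasJet l g a b c)
    (ha : a = a') (hb : b = b') (hc : c = c') : HasJet l g a' b' c' := by
  subst ha hb hc; exact hg

lemma HasJet.unique {g : (Fin m → ℝ) → ℝ} {a b c a' b' c' : ℝ} (hg : HasJet l g a b c)
    (hg' : HasJet l g a' b' c') : a = a' ∧ b = b' ∧ c = c' := by
  obtain ⟨_, h2, h3, h4⟩ := hg
  obtain ⟨_, k2, k3, k4⟩ := hg'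
  exact ⟨h2.symm.trans k2, h3.symm.trans k3, h4.symm.trans k4⟩

lemma HasJet.of_smooth {g : (Fin m → ℝ) → ℝ} (hg : ContDiffAt ℝ (⊤ : ℕ∞) g 0) :
    HasJet l g (g 0) (pd l g 0) (pd l (fun u => pd l g u) 0) := ⟨hg, rfl, rfl, rfl⟩

lemma HasJet.const (k : ℝ) : HasJet l (fun _ => k) k 0 0 := by
  refine ⟨contDiffAt_const, rfl, pd_const _ _ _, ?_⟩
  simp only [pd_const]

lemma HasJet.add {g h : (Fin m → ℝ) → ℝ} {a b c a' b' c' : ℝ} (hg : HasJet l g a b c)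
    (hh : HasJet l h a' b' c') :
    HasJet l (fun u => g u + h u) (a + a') (b + b') (c + c') := by
  obtain ⟨h1, rfl, rfl, rfl⟩ := hg
  obtain ⟨k1, rfl, rfl, rfl⟩ := hh
  refine ⟨h1.add k1, rfl, pd_add l (smooth_diff h1) (smooth_diff k1), ?_⟩
  have e : (fun u => pd l (fun u => g u + h u) u) =ᶠ[𝓝 0] fun u => pd l g u + pd l h u := by
    filter_upwards [smooth_ev h1, smooth_ev k1] with u hu ku using pd_add l hu ku
  rw [pd_congr l e, pd_add l (smooth_diff (smooth_pd l h1)) (smooth_diff (smooth_pd l k1))]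

lemma HasJet.mul {g h : (Fin m → ℝ) → ℝ} {a b c a' b' c' : ℝ} (hg : HasJet l g a b c)
    (hh : HasJet l h a' b' c') :
    HasJet l (fun u => g u * h u) (a * a') (a * b' + b * a') (a * c' + 2 * (b * b') + c * a') := by
  obtain ⟨h1, rfl, rfl, rfl⟩ := hg
  obtain ⟨k1, rfl, rfl, rfl⟩ := hh
  refine ⟨h1.mul k1, rfl, by rw [pd_mul l (smooth_diff h1) (smooth_diff k1)]; ring, ?_⟩
  have e : (fun u => pd l (fun u => g u * h u) u) =ᶠ[𝓝 0]
      fun u => g u * pd l h u + h u * pd l g u := by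
    filter_upwards [smooth_ev h1, smooth_ev k1] with u hu ku using pd_mul l hu ku
  have d1 := smooth_diff h1
  have d2 := smooth_diff k1
  have d3 := smooth_diff (smooth_pd l h1)
  have d4 := smooth_diff (smooth_pd l k1)
  rw [pd_congr l e, pd_add (g := fun u => g u * pd l h u) (h := fun u => h u * pd l g u) l (d1.mul d4) (d2.mul d3),
    pd_mul l d1 d4, pd_mul l d2 d3]
  ring

lemma HasJet.neg {g : (Fin m → ℝ) → ℝ} {a b c : ℝ} (hg : HasJet l g a b c) :
    HasJet l (fun u => - g u) (-a) (-b) (-c) := by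
  have := (HasJet.const (l := l) (-1)).mul hg
  simpa using this

lemma HasJet.sum {ι : Type*} (s : Finset ι) {g : ι → (Fin m → ℝ) → ℝ} {a b c : ι → ℝ}
    (hg : ∀ i, HasJet l (g i) (a i) (b i) (c i)) :
    HasJet l (fun u => ∑ i ∈ s, g i u) (∑ i ∈ s, a i) (∑ i ∈ s, b i) (∑ i ∈ s, c i) := by
  classical
  induction s using Finset.induction_on with
  | empty => simpa using HasJet.const (l := l) 0
  | insert i s hi ih => simpa [Finset.sum_insert hi] using (hg i).add ih

lemma smooth_det {n : ℕ} {G : (Fin m → ℝ) → Matrix (Fin n) (Fin n) ℝ}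
    (hG : ∀ i j, ContDiffAt ℝ (⊤ : ℕ∞) (fun u => G u i j) 0) :
    ContDiffAt ℝ (⊤ : ℕ∞) (fun u => (G u).det) 0 := by
  simp only [Matrix.det_apply']
  refine ContDiffAt.sum fun s _ => contDiffAt_const.mul ?_
  exact contDiffAt_prod fun i _ => hG _ _

lemma smooth_inv {n : ℕ} {G : (Fin m → ℝ) → Matrix (Fin n) (Fin n) ℝ}
    (hG : ∀ i j, ContDiffAt ℝ (⊤ : ℕ∞) (fun u => G u i j) 0) (h0 : (G 0).det ≠ 0) (i j : Fin n) :
    ContDiffAt ℝ (⊤ : ℕ∞) (fun u => (G u)⁻¹ i j) 0 := by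
  simp only [Matrix.inv_def, Matrix.smul_apply, smul_eq_mul, Ring.inverse_eq_inv',
    Matrix.adjugate_apply]
  refine ((smooth_det hG).inv h0).mul (smooth_det fun a b => ?_)
  by_cases h : a = j
  · subst h; simp only [Matrix.updateRow_self]; exact contDiffAt_const
  · simp only [Matrix.updateRow_ne h]; exact hG a b

lemma jet_inv {n : ℕ} {G : (Fin m → ℝ) → Matrix (Fin n) (Fin n) ℝ} {S : Fin n → Fin n → ℝ}
    (hG : ∀ i j, HasJet l (fun u => G u i j) (if i = j then 1 else 0) 0 (S i j)) (i j : Fin n) :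
    HasJet l (fun u => (G u)⁻¹ i j) (if i = j then 1 else 0) 0 (- S i j) := by
  have hG0 : G 0 = 1 := by
    ext i j; rw [Matrix.one_apply]; exact (hG i j).2.1
  have h0 : (G 0).det ≠ 0 := by simp [hG0]
  have hX := fun i j => HasJet.of_smooth (l := l) (smooth_inv (fun i j => (hG i j).1) h0 i j)
  have hev : ∀ᶠ u in 𝓝 0, (G u).det ≠ 0 :=
    (smooth_det (fun i j => (hG i j).1)).continuousAt.eventually_ne h0
  have hone : ∀ i j, (fun u => ∑ k, G u i k * (G u)⁻¹ k j) =ᶠ[𝓝 0]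
      fun _ => if i = j then 1 else 0 := by
    intro i j
    filter_upwards [hev] with u hu
    rw [← Matrix.mul_apply, Matrix.mul_nonsing_inv _ (isUnit_iff_ne_zero.mpr hu), Matrix.one_apply]
  have hp := fun i j => HasJet.sum (l := l) Finset.univ (fun k => (hG i k).mul (hX k j))
  have hu := fun i j => (hp i j).unique ((HasJet.const (l := l) _).congr (hone i j))
  have h00 : ∀ i j, (G 0)⁻¹ i j = if i = j then 1 else 0 := by
    intro i j; simp [hG0, Matrix.one_apply]
  refine (hX i j).eq (h00 i j) ?_ ?_
  · have := (hu i j).2.1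
    simpa using this
  · have := (hu i j).2.2
    simp [h00, Finset.sum_add_distrib] at this
    linarith

end

lemma sum_rot {α β γ : Type*} [Fintype α] [Fintype β] [Fintype γ] (F : α → β → γ → ℝ) :
    ∑ a, ∑ b, ∑ c, F a b c = ∑ b, ∑ c, ∑ a, F a b c := by
  rw [Finset.sum_comm]
  exact Finset.sum_congr rfl fun b _ => Finset.sum_comm

lemma sum_rot2 {α β γ : Type*} [Fintype α] [Fintype β] [Fintype γ] (a : α → β → γ → ℝ) :
    ∑ i, ∑ j, ∑ k, ∑ l, a i k l * a j k l = ∑ k, ∑ l, (∑ i, a i k l) ^ 2 := by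
  simp only [pow_two, Finset.sum_mul_sum]
  rw [← sum_rot (fun i k l => ∑ j, a i k l * a j k l)]
  exact Finset.sum_congr rfl fun i _ => sum_rot (fun j k l => a i k l * a j k l)

lemma sum_pull {α β : Type*} [Fintype α] [Fintype β] (h : β → ℝ) (Q : α → ℝ) (b : α → β → ℝ) :
    ∑ t, h t * ∑ k, Q k * b k t = ∑ k, Q k * ∑ t, h t * b k t := by
  simp only [Finset.mul_sum]
  rw [Finset.sum_comm]
  exact Finset.sum_congr rfl fun k _ => Finset.sum_congr rfl fun t _ => by ring

lemma sum_pull2 {α γ β : Type*} [Fintype α] [Fintype β] [Fintype γ] (h : β → ℝ)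
    (Q : α → γ → ℝ) (b : α → γ → β → ℝ) :
    ∑ t, h t * ∑ k, ∑ j, Q k j * b k j t = ∑ k, ∑ j, Q k j * ∑ t, h t * b k j t := by
  simp only [Finset.mul_sum]
  rw [sum_rot]
  exact Finset.sum_congr rfl fun k _ => Finset.sum_congr rfl fun j _ =>
    Finset.sum_congr rfl fun t _ => by ring

/-- For `M = graph(f) ⊂ ℝ^{m+d}` tangent to `ℝ^m × {0}` at the origin, with induced metric
Gram matrix `G(u)_{ij} = δ_{ij} + ⟨∂_i f, ∂_j f⟩` and mean curvature vector `H(u)` given in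
ambient coordinates by the stated formulas, the Euclidean Laplacian of `‖H‖²` at `0` equals
`−2 Σ⟨f_{ii},f_{kℓ}⟩⟨f_{jj},f_{kℓ}⟩ − 4 Σ⟨f_{iℓ},f_{jℓ}⟩⟨f_{ij},f_{kk}⟩
 + 2 Σ⟨f_{iik},f_{jjk}⟩ + 2 Σ⟨f_{kk},f_{iiℓℓ}⟩`. -/
theorem stmt6 (m d : ℕ) (hm : 1 ≤ m) (hd : 1 ≤ d)
    (f : (Fin m → ℝ) → (Fin d → ℝ))
    (hf : ∃ U : Set (Fin m → ℝ), IsOpen U ∧ (0 : Fin m → ℝ) ∈ U ∧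
      ∀ τ : Fin d, ContDiffOn ℝ (⊤ : ℕ∞) (fun u => f u τ) U)
    (hf0 : f 0 = 0) (hdf0 : ∀ i τ, pd i (fun u => f u τ) 0 = 0)
    (G : (Fin m → ℝ) → Matrix (Fin m) (Fin m) ℝ)
    (hG : ∀ u i j, G u i j = (if i = j then (1:ℝ) else 0) +
      ∑ τ, pd i (fun w => f w τ) u * pd j (fun w => f w τ) u)
    (H : (Fin m → ℝ) → (Fin m ⊕ Fin d) → ℝ)
    (hHtan : ∀ u σ, H u (Sum.inl σ) =
      -∑ i, ∑ j, ∑ p, (G u)⁻¹ i j * (G u)⁻¹ σ p *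
        (∑ τ, pd p (fun w => f w τ) u * pd i (fun v => pd j (fun w => f w τ) v) u))
    (hHnor : ∀ u τ, H u (Sum.inr τ) =
      (∑ i, ∑ j, (G u)⁻¹ i j * pd i (fun v => pd j (fun w => f w τ) v) u)
        - ∑ i, ∑ j, ∑ k, ∑ p, (G u)⁻¹ i j * (G u)⁻¹ k p *
            (∑ τ', pd p (fun w => f w τ') u * pd i (fun v => pd j (fun w => f w τ') v) u) *
              pd k (fun w => f w τ) u)
    (D2 : Fin m → Fin m → Fin d → ℝ)
    (hD2 : ∀ i j τ, D2 i j τ = pd i (fun v => pd j (fun w => f w τ) v) 0)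
    (D3 : Fin m → Fin m → Fin m → Fin d → ℝ)
    (hD3 : ∀ i j k τ, D3 i j k τ =
      pd i (fun v => pd j (fun v' => pd k (fun w => f w τ) v') v) 0)
    (D4 : Fin m → Fin m → Fin m → Fin m → Fin d → ℝ)
    (hD4 : ∀ i j k l τ, D4 i j k l τ =
      pd i (fun v => pd j (fun v' => pd k (fun v'' => pd l (fun w => f w τ) v'') v') v) 0) :
    ∑ l, pd l (fun u => pd l (fun v => ∑ σ : Fin m ⊕ Fin d, (H v σ) ^ 2) u) 0
      = -2 * (∑ i, ∑ j, ∑ k, ∑ l,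
            (∑ τ, D2 i i τ * D2 k l τ) * (∑ τ, D2 j j τ * D2 k l τ))
        - 4 * (∑ i, ∑ j, ∑ k, ∑ l,
            (∑ τ, D2 i l τ * D2 j l τ) * (∑ τ, D2 i j τ * D2 k k τ))
        + 2 * (∑ i, ∑ j, ∑ k, (∑ τ, D3 i i k τ * D3 j j k τ))
        + 2 * (∑ i, ∑ k, ∑ l, (∑ τ, D2 k k τ * D4 i i l l τ)) := by
  obtain ⟨U, hU, h0U, hfU⟩ := hf
  have sf : ∀ τ, ContDiffAt ℝ (⊤ : ℕ∞) (fun u => f u τ) 0 :=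
    fun τ => (hfU τ).contDiffAt (hU.mem_nhds h0U)
  have sfe : ∀ τ, ∀ᶠ u in 𝓝 0, ContDiffAt ℝ (⊤ : ℕ∞) (fun u => f u τ) u := by
    intro τ
    filter_upwards [hU.mem_nhds h0U] with u hu using (hfU τ).contDiffAt (hU.mem_nhds hu)
  have s1 : ∀ k τ, ContDiffAt ℝ (⊤ : ℕ∞) (fun u => pd k (fun w => f w τ) u) 0 :=
    fun k τ => smooth_pd k (sf τ)
  have s2 : ∀ i j τ, ContDiffAt ℝ (⊤ : ℕ∞)
      (fun u => pd i (fun v => pd j (fun w => f w τ) v) u) 0 :=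
    fun i j τ => smooth_pd i (s1 j τ)
  -- symmetry
  have D2s : ∀ i j τ, D2 i j τ = D2 j i τ := by
    intro i j τ; rw [hD2, hD2]; exact pd_comm i j (sf τ)
  have D3s : ∀ l i τ, D3 l i i τ = D3 i i l τ := by
    intro l i τ
    rw [hD3, hD3, pd_comm l i (s1 i τ)]
    apply pd_congr
    filter_upwards [sfe τ] with u hu using pd_comm l i hu
  -- jets
  have J1 : ∀ l k τ, HasJet l (fun u => pd k (fun w => f w τ) u) 0 (D2 l k τ) (D3 l l k τ) :=
    fun l k τ => ⟨s1 k τ, hdf0 k τ, (hD2 l k τ).symm, (hD3 l l k τ).symm⟩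
  have J2 : ∀ l i j τ, HasJet l (fun u => pd i (fun v => pd j (fun w => f w τ) v) u)
      (D2 i j τ) (D3 l i j τ) (D4 l l i j τ) :=
    fun l i j τ => ⟨s2 i j τ, (hD2 i j τ).symm, (hD3 l i j τ).symm, (hD4 l l i j τ).symm⟩
  have JG : ∀ l i j, HasJet l (fun u => G u i j) (if i = j then 1 else 0) 0
      (∑ τ, 2 * (D2 l i τ * D2 l j τ)) := by
    intro l i j
    simp only [hG]
    refine ((HasJet.const _).add
      (HasJet.sum Finset.univ fun τ => (J1 l i τ).mul (J1 l j τ))).eq ?_ ?_ ?_ <;> simp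
  have JX := fun l i j => jet_inv (JG l) i j
  -- inner products
  have JI : ∀ l p i j, ∃ c, HasJet l (fun u => ∑ τ, pd p (fun w => f w τ) u *
      pd i (fun v => pd j (fun w => f w τ) v) u) 0 (∑ τ, D2 l p τ * D2 i j τ) c := by
    intro l p i j
    refine ⟨_, (HasJet.sum Finset.univ fun τ => (J1 l p τ).mul (J2 l i j τ)).eq ?_ ?_ rfl⟩ <;> simp
  choose cI JI using JI
  have JT : ∀ l i j σ p, ∃ c, HasJet l (fun u => (G u)⁻¹ i j * (G u)⁻¹ σ p *
        (∑ τ, pd p (fun w => f w τ) u * pd i (fun v => pd j (fun w => f w τ) v) u)) 0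
      (if i = j then if σ = p then ∑ τ, D2 l p τ * D2 i j τ else 0 else 0) c := by
    intro l i j σ p
    refine ⟨_, (((JX l i j).mul (JX l σ p)).mul (JI l p i j)).eq ?_ ?_ rfl⟩
    · simp
    · split_ifs <;> simp
  choose cT JT using JT
  have JHt : ∀ l σ, ∃ c, HasJet l (fun u => H u (Sum.inl σ)) 0
      (-∑ i, ∑ τ, D2 l σ τ * D2 i i τ) c := by
    intro l σ
    simp only [hHtan]
    refine ⟨_, (HasJet.sum Finset.univ fun i => HasJet.sum Finset.univ fun j =>
      HasJet.sum Finset.univ fun p => JT l i j σ p).neg.eq ?_ ?_ rfl⟩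
    · simp
    · simp
  choose cH JHt using JHt
  have JN1 : ∀ l τ, HasJet l
      (fun u => ∑ i, ∑ j, (G u)⁻¹ i j * pd i (fun v => pd j (fun w => f w τ) v) u)
      (∑ i, D2 i i τ) (∑ i, D3 i i l τ)
      (∑ i, D4 l l i i τ - 2 * ∑ i, ∑ j, (∑ τ', D2 i l τ' * D2 j l τ') * D2 i j τ) := by
    intro l τ
    refine (HasJet.sum Finset.univ fun i => HasJet.sum Finset.univ fun j =>
      (JX l i j).mul (J2 l i j τ)).eq ?_ ?_ ?_
    · simp
    · simp only [← D3s l]; simp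
    · simp [Finset.sum_add_distrib, D2s l, ← Finset.mul_sum, mul_assoc, sub_eq_add_neg]
  have JN2 : ∀ l τ, HasJet l
      (fun u => ∑ i, ∑ j, ∑ k, ∑ p, (G u)⁻¹ i j * (G u)⁻¹ k p *
            (∑ τ', pd p (fun w => f w τ') u * pd i (fun v => pd j (fun w => f w τ') v) u) *
              pd k (fun w => f w τ) u)
      0 0 (2 * ∑ i, ∑ k, (∑ τ', D2 i i τ' * D2 k l τ') * D2 k l τ) := by
    intro l τ
    refine (HasJet.sum Finset.univ fun i => HasJet.sum Finset.univ fun j =>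
      HasJet.sum Finset.univ fun k => HasJet.sum Finset.univ fun p =>
        (JT l i j k p).mul (J1 l k τ)).eq ?_ ?_ ?_
    · simp
    · simp
    · simp [D2s l, ← Finset.mul_sum, mul_comm]
  have JHn : ∀ l τ, HasJet l (fun u => H u (Sum.inr τ)) (∑ i, D2 i i τ) (∑ i, D3 i i l τ)
      (∑ i, D4 l l i i τ - 2 * ∑ i, ∑ j, (∑ τ', D2 i l τ' * D2 j l τ') * D2 i j τ
        - 2 * ∑ i, ∑ k, (∑ τ', D2 i i τ' * D2 k l τ') * D2 k l τ) := by
    intro l τ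
    simp only [hHnor, sub_eq_add_neg]
    refine ((JN1 l τ).add (JN2 l τ).neg).eq ?_ ?_ ?_
    · simp
    · simp
    · ring
  have Jtot : ∀ l, pd l (fun u => pd l (fun v => ∑ σ : Fin m ⊕ Fin d, (H v σ) ^ 2) u) 0 =
      2 * ∑ k, (∑ i, ∑ τ, D2 i i τ * D2 k l τ) ^ 2
      + 2 * ∑ τ, (∑ i, D3 i i l τ) ^ 2
      + 2 * ∑ τ, (∑ i, D2 i i τ) * (∑ i, D4 l l i i τ
        - 2 * ∑ i, ∑ j, (∑ τ', D2 i l τ' * D2 j l τ') * D2 i j τ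
        - 2 * ∑ i, ∑ k, (∑ τ', D2 i i τ' * D2 k l τ') * D2 k l τ) := by
    intro l
    have := ((HasJet.sum Finset.univ fun σ => (JHt l σ).mul (JHt l σ)).add
      (HasJet.sum Finset.univ fun τ => (JHn l τ).mul (JHn l τ))).2.2.2
    simp only [Fintype.sum_sum_type, pow_two]
    refine this.trans ?_
    simp only [zero_mul, mul_zero, zero_add, add_zero, neg_mul_neg, Finset.mul_sum]
    rw [add_assoc, ← Finset.sum_add_distrib]
    congr 1
    · refine Finset.sum_congr rfl fun k _ => ?_
      simp only [D2s l, mul_comm (D2 k l _)]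
    · refine Finset.sum_congr rfl fun τ _ => ?_
      simp only [← Finset.mul_sum]
      ring
  simp only [Jtot]
  have hq : ∀ k l, ∑ i, ∑ τ, D2 i i τ * D2 k l τ = ∑ τ, (∑ i, D2 i i τ) * D2 k l τ := by
    intro k l
    rw [Finset.sum_comm]
    simp only [Finset.sum_mul]
  have hA : ∑ i, ∑ j, ∑ k, ∑ l, (∑ τ, D2 i i τ * D2 k l τ) * (∑ τ, D2 j j τ * D2 k l τ)
      = ∑ l, ∑ k, (∑ i, ∑ τ, D2 i i τ * D2 k l τ) ^ 2 := by
    rw [sum_rot2 (fun i k l => ∑ τ, D2 i i τ * D2 k l τ), Finset.sum_comm]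
  have hB : ∀ l, ∑ τ, (∑ i, D2 i i τ) * (∑ i, ∑ k, (∑ τ', D2 i i τ' * D2 k l τ') * D2 k l τ)
      = ∑ k, (∑ i, ∑ τ, D2 i i τ * D2 k l τ) ^ 2 := by
    intro l
    have : ∀ τ, ∑ i, ∑ k, (∑ τ', D2 i i τ' * D2 k l τ') * D2 k l τ
        = ∑ k, (∑ i, ∑ τ', D2 i i τ' * D2 k l τ') * D2 k l τ := by
      intro τ
      rw [Finset.sum_comm]
      simp only [Finset.sum_mul]
    simp only [this, pow_two]
    rw [sum_pull]
    simp only [hq]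
  have hC : ∑ l, ∑ τ, (∑ i, D2 i i τ) * (∑ i, ∑ j, (∑ τ', D2 i l τ' * D2 j l τ') * D2 i j τ)
      = ∑ i, ∑ j, ∑ k, ∑ l, (∑ τ, D2 i l τ * D2 j l τ) * (∑ τ, D2 i j τ * D2 k k τ) := by
    have h1 : ∀ l, ∑ τ, (∑ i, D2 i i τ) * (∑ i, ∑ j, (∑ τ', D2 i l τ' * D2 j l τ') * D2 i j τ)
        = ∑ i, ∑ j, (∑ τ', D2 i l τ' * D2 j l τ') * ∑ k, ∑ τ, D2 i j τ * D2 k k τ := by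
      intro l
      rw [sum_pull2]
      refine Finset.sum_congr rfl fun i _ => Finset.sum_congr rfl fun j _ => ?_
      rw [← hq i j]
      congr 1
      exact Finset.sum_congr rfl fun k _ => Finset.sum_congr rfl fun τ _ => mul_comm _ _
    simp only [h1]
    rw [Finset.sum_comm]
    refine Finset.sum_congr rfl fun i _ => ?_
    rw [Finset.sum_comm]
    refine Finset.sum_congr rfl fun j _ => ?_
    conv_rhs => rw [Finset.sum_comm]
    refine Finset.sum_congr rfl fun l _ => ?_
    rw [Finset.mul_sum]
  have hD : ∑ l, ∑ τ, (∑ i, D3 i i l τ) ^ 2 = ∑ i, ∑ j, ∑ k, ∑ τ, D3 i i k τ * D3 j j k τ := by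
    rw [sum_rot2 (fun i k τ => D3 i i k τ)]
  have hE : ∑ l, ∑ τ, (∑ i, D2 i i τ) * (∑ i, D4 l l i i τ)
      = ∑ i, ∑ k, ∑ l, ∑ τ, D2 k k τ * D4 i i l l τ := by
    simp only [Finset.sum_mul_sum]
    refine Finset.sum_congr rfl fun i _ => ?_
    rw [Finset.sum_comm]
    refine Finset.sum_congr rfl fun k _ => ?_
    rw [Finset.sum_comm]
  rw [← hC, ← hD, ← hE, hA]
  simp only [mul_sub, mul_left_comm _ (2 : ℝ), Finset.sum_sub_distrib, Finset.sum_add_distrib, ← Finset.mul_sum, hB]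
  ring
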